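/- arXiv:2509.06091 — 5 statements merged into one kernel-verified Lean document; each statement's English description precedes it below -/
import Mathlib

section
/- There exists a finite simple graph G that admits no partition of its vertex set into vertex-disjoint triangles (i.e., no collection of vertex-disjoint subgraphs isomorphic to K_3 covering every vertex exactly once), but which does admit a collection of triangle subgraphs (subgraphs isomorphic to K_3) such that every vertex of G lies in exactly two triangles of the collection. -/
/-! Framework: copies of `H`, (c,H)-packings and partitions, gadgets,
coherence, and realization of relations, following the paper's definitions. -/

open scoped Classical

/-- Number of members of the multiset `P` of subgraphs of `G` containing `v`. -/
noncomputable def coverM {V : Type} {G : SimpleGraph V} (P : Multiset G.Subgraph) (v : V) : ℕ :=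
  (P.map fun Z => if v ∈ Z.verts then 1 else 0).sum

/-- Number of members of the finite set `P` of subgraphs of `G` containing `v`. -/
noncomputable def coverF {V : Type} {G : SimpleGraph V} (P : Finset G.Subgraph) (v : V) : ℕ :=
  coverM P.val v

/-- `Z` is a copy of `H`, i.e. a subgraph of `G` isomorphic to `H`. -/
def IsCopy {α V : Type} (H : SimpleGraph α) {G : SimpleGraph V} (Z : G.Subgraph) : Prop :=
  Nonempty (Z.coe ≃g H)

/-- An arbitrary `(c,H)`-partition: a multiset of copies of `H` in `G` covering
every vertex exactly `c` times. -/
def IsArbPartition {α V : Type} (H : SimpleGraph α) (c : ℕ) {G : SimpleGraph V}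
    (P : Multiset G.Subgraph) : Prop :=
  (∀ Z ∈ P, IsCopy H Z) ∧ ∀ v : V, coverM P v = c

/-- A distinct `(c,H)`-partition: a set of copies of `H` in `G` covering
every vertex exactly `c` times. -/
def IsDistPartition {α V : Type} (H : SimpleGraph α) (c : ℕ) {G : SimpleGraph V}
    (P : Finset G.Subgraph) : Prop :=
  (∀ Z ∈ P, IsCopy H Z) ∧ ∀ v : V, coverF P v = c

/-- The gadget `G` with portal vertices `portals` is `(c,H)`-coherent: in every
extension `E` of `G` (given by an induced embedding `ι` such that internal vertices
keep all their neighbours inside the gadget), every member of an arbitrary-or-distinct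
`(c,H)`-partition of `E` containing an internal vertex of the gadget lies entirely
inside the gadget. -/
def Coherent {α V : Type} (H : SimpleGraph α) (c : ℕ) {ℓ : ℕ}
    (G : SimpleGraph V) (portals : Fin ℓ → V) : Prop :=
  ∀ (W : Type) (E : SimpleGraph W) (ι : V → W),
    Function.Injective ι →
    (∀ a b : V, E.Adj (ι a) (ι b) ↔ G.Adj a b) →
    (∀ v : V, v ∉ Set.range portals → ∀ w : W, E.Adj (ι v) w → w ∈ Set.range ι) →
    ∀ P : Multiset E.Subgraph, IsArbPartition H c P →
      ∀ Z ∈ P, (∃ v : V, v ∉ Set.range portals ∧ ι v ∈ Z.verts) →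
        Z.verts ⊆ Set.range ι

/-- The gadget `(G, portals)` dist-`(c,H)`-realizes the relation `R ⊆ {0,…,c}^ℓ`. -/
def DistRealizes {α V : Type} (H : SimpleGraph α) (c : ℕ) {ℓ : ℕ}
    (G : SimpleGraph V) (portals : Fin ℓ → V) (R : Set (Fin ℓ → ℕ)) : Prop :=
  ∀ r : Fin ℓ → ℕ, (∀ i, r i ≤ c) →
    (r ∈ R ↔ ∃ P : Finset G.Subgraph,
      (∀ Z ∈ P, IsCopy H Z) ∧
      (∀ v : V, coverF P v ≤ c) ∧
      (∀ v : V, v ∉ Set.range portals → coverF P v = c) ∧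
      (∀ i : Fin ℓ, coverF P (portals i) = r i))

/-- The gadget `(G, portals)` arb-`(c,H)`-realizes the relation `R ⊆ {0,…,c}^ℓ`. -/
def ArbRealizes {α V : Type} (H : SimpleGraph α) (c : ℕ) {ℓ : ℕ}
    (G : SimpleGraph V) (portals : Fin ℓ → V) (R : Set (Fin ℓ → ℕ)) : Prop :=
  ∀ r : Fin ℓ → ℕ, (∀ i, r i ≤ c) →
    (r ∈ R ↔ ∃ P : Multiset G.Subgraph,
      (∀ Z ∈ P, IsCopy H Z) ∧
      (∀ v : V, coverM P v ≤ c) ∧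
      (∀ v : V, v ∉ Set.range portals → coverM P v = c) ∧
      (∀ i : Fin ℓ, coverM P (portals i) = r i))

/-- Strict realization: both dist- and arb-realization. -/
def StrictRealizes {α V : Type} (H : SimpleGraph α) (c : ℕ) {ℓ : ℕ}
    (G : SimpleGraph V) (portals : Fin ℓ → V) (R : Set (Fin ℓ → ℕ)) : Prop :=
  DistRealizes H c G portals R ∧ ArbRealizes H c G portals R

/-- The relation NEQ_c = {(x, c−x) : 0 ≤ x ≤ c}. -/
def NEQrel (c : ℕ) : Set (Fin 2 → ℕ) := {r | ∃ x ≤ c, r 0 = x ∧ r 1 = c - x}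

theorem coverF_eq_card_filter {V : Type} {G : SimpleGraph V} (P : Finset G.Subgraph) (v : V) :
    coverF P v = (P.filter fun Z => v ∈ Z.verts).card := by
  rw [Finset.card_filter]
  rfl

/-- In a `1`-partition, two members sharing a vertex coincide. -/
theorem IsDistPartition.eq_of_mem_verts {α V : Type} {H : SimpleGraph α} {G : SimpleGraph V}
    {P : Finset G.Subgraph} (hP : IsDistPartition H 1 P) {Z Z' : G.Subgraph}
    (hZ : Z ∈ P) (hZ' : Z' ∈ P) {v : V} (hv : v ∈ Z.verts) (hv' : v ∈ Z'.verts) : Z = Z' := by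
  have h := hP.2 v
  rw [coverF_eq_card_filter] at h
  exact Finset.card_le_one.mp h.le Z (by simp [hZ, hv]) Z' (by simp [hZ', hv'])

theorem IsDistPartition.exists_mem_verts {α V : Type} {H : SimpleGraph α} {G : SimpleGraph V}
    {P : Finset G.Subgraph} (hP : IsDistPartition H 1 P) (v : V) : ∃ Z ∈ P, v ∈ Z.verts := by
  have h := hP.2 v
  rw [coverF_eq_card_filter] at h
  obtain ⟨Z, hZ⟩ := Finset.card_pos.mp (h ▸ Nat.one_pos)
  exact ⟨Z, Finset.mem_filter.mp hZ⟩

theorem IsCopy.adj_of_ne {α V : Type} {G : SimpleGraph V} {Z : G.Subgraph}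
    (hZ : IsCopy (⊤ : SimpleGraph α) Z) {x y : V} (hx : x ∈ Z.verts) (hy : y ∈ Z.verts)
    (hxy : x ≠ y) : G.Adj x y := by
  obtain ⟨e⟩ := hZ
  have h : (⊤ : SimpleGraph α).Adj (e ⟨x, hx⟩) (e ⟨y, hy⟩) := by
    simpa using hxy
  exact Z.adj_sub (e.map_adj_iff.mp h)

/-- A vertex of a triangle has two further vertices of the triangle adjacent to it. -/
theorem IsCopy.exists_triangle {V : Type} {G : SimpleGraph V} {Z : G.Subgraph}
    (hZ : IsCopy (⊤ : SimpleGraph (Fin 3)) Z) {v : V} (hv : v ∈ Z.verts) :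
    ∃ x ∈ Z.verts, ∃ y ∈ Z.verts, G.Adj v x ∧ G.Adj v y ∧ G.Adj x y := by
  obtain ⟨e⟩ := id hZ
  obtain ⟨i, j, hi, hj, hij⟩ : ∃ i j : Fin 3, e ⟨v, hv⟩ ≠ i ∧ e ⟨v, hv⟩ ≠ j ∧ i ≠ j := by
    generalize e ⟨v, hv⟩ = k
    revert k
    decide
  have ne_symm_apply : ∀ k, e ⟨v, hv⟩ ≠ k → v ≠ (e.symm k : V) := by
    rintro k hk rfl
    exact hk (e.apply_symm_apply k)
  refine ⟨e.symm i, (e.symm i).2, e.symm j, (e.symm j).2,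
    hZ.adj_of_ne hv (e.symm i).2 (ne_symm_apply i hi),
    hZ.adj_of_ne hv (e.symm j).2 (ne_symm_apply j hj),
    hZ.adj_of_ne (e.symm i).2 (e.symm j).2 fun h => hij (e.symm.injective (Subtype.ext h))⟩

theorem isCopy_top_induce_range {α V : Type} {G : SimpleGraph V} (t : α → V)
    (ht : ∀ i j, i ≠ j → G.Adj (t i) (t j)) :
    IsCopy (⊤ : SimpleGraph α) ((⊤ : G.Subgraph).induce (Set.range t)) := by
  have inj : Function.Injective t := fun i j h => by
    by_contra hij
    exact (ht i j hij).ne h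
  refine ⟨RelIso.symm ⟨Equiv.ofInjective t inj, ?_⟩⟩
  intro i j
  exact ⟨fun h hij => h.2.2.ne (congrArg t hij),
    fun hij => ⟨Set.mem_range_self i, Set.mem_range_self j, ht i j hij⟩⟩

/-- The edges at each vertex of the triangular prism, whose edges are numbered so that
`0, 1, 2` and `6, 7, 8` form the two triangular faces. -/
def prismStar : Fin 6 → Fin 3 → Fin 9 :=
  ![![0, 2, 3], ![0, 1, 4], ![1, 2, 5], ![6, 8, 3], ![6, 7, 4], ![7, 8, 5]]

/-- The line graph of the triangular prism. -/
def prismLineGraph : SimpleGraph (Fin 9) where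
  Adj x y := x ≠ y ∧ ∃ k, (∃ i, prismStar k i = x) ∧ ∃ j, prismStar k j = y
  symm := ⟨fun _ _ ⟨hne, k, hx, hy⟩ => ⟨hne.symm, k, hy, hx⟩⟩
  loopless := ⟨fun _ h => h.1 rfl⟩

instance prismLineGraph.decidableAdj : DecidableRel prismLineGraph.Adj := fun x y =>
  inferInstanceAs (Decidable (x ≠ y ∧ ∃ k, (∃ i, prismStar k i = x) ∧ ∃ j, prismStar k j = y))

theorem prismLineGraph_triangle_three : ∀ x y, prismLineGraph.Adj 3 x → prismLineGraph.Adj 3 y →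
    prismLineGraph.Adj x y → ({0, 2} : Finset (Fin 9)) = {x, y} ∨ {6, 8} = ({x, y} : Finset _) := by
  decide +kernel

theorem prismLineGraph_triangle_one : ∀ x y, prismLineGraph.Adj 1 x → prismLineGraph.Adj 1 y →
    prismLineGraph.Adj x y → x ∈ ({0, 2} : Finset (Fin 9)) ∨ y ∈ ({0, 2} : Finset (Fin 9)) := by
  decide +kernel

theorem prismLineGraph_triangle_seven : ∀ x y, prismLineGraph.Adj 7 x → prismLineGraph.Adj 7 y →
    prismLineGraph.Adj x y → x ∈ ({6, 8} : Finset (Fin 9)) ∨ y ∈ ({6, 8} : Finset (Fin 9)) := by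
  decide +kernel

theorem prismLineGraph_not_isDistPartition (P : Finset prismLineGraph.Subgraph) :
    ¬ IsDistPartition (⊤ : SimpleGraph (Fin 3)) 1 P := by
  intro hP
  obtain ⟨Z, hZ, h3⟩ := hP.exists_mem_verts 3
  -- The triangle through `3` blocks every triangle through `v`.
  have blocked : ∀ (s : Finset (Fin 9)) (v : Fin 9), 3 ≠ v → ¬ prismLineGraph.Adj 3 v →
      (∀ x y, prismLineGraph.Adj v x → prismLineGraph.Adj v y → prismLineGraph.Adj x y →
        x ∈ s ∨ y ∈ s) → ¬ ∀ x ∈ s, x ∈ Z.verts := by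
    intro s v hne hnadj hs hsZ
    obtain ⟨Z', hZ', hv⟩ := hP.exists_mem_verts v
    obtain ⟨x, hx, y, hy, hvx, hvy, hxy⟩ := (hP.1 Z' hZ').exists_triangle hv
    have hZZ' : Z = Z' := (hs x y hvx hvy hxy).elim
      (fun h => hP.eq_of_mem_verts hZ hZ' (hsZ x h) hx)
      (fun h => hP.eq_of_mem_verts hZ hZ' (hsZ y h) hy)
    exact hnadj ((hP.1 Z hZ).adj_of_ne h3 (hZZ' ▸ hv) hne)
  obtain ⟨x, hx, y, hy, h3x, h3y, hxy⟩ := (hP.1 Z hZ).exists_triangle h3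
  have hsub : ∀ z ∈ ({x, y} : Finset (Fin 9)), z ∈ Z.verts := by
    simp [hx, hy]
  rcases prismLineGraph_triangle_three x y h3x h3y hxy with h | h
  · exact blocked _ 1 (by decide) (by decide) prismLineGraph_triangle_one (h ▸ hsub)
  · exact blocked _ 7 (by decide) (by decide) prismLineGraph_triangle_seven (h ▸ hsub)

theorem prismStar_adj : ∀ k i j, i ≠ j → prismLineGraph.Adj (prismStar k i) (prismStar k j) := by
  decide +kernel

theorem card_prismStar_incident (v : Fin 9) :
    (Finset.univ.filter fun k => ∃ i, prismStar k i = v).card = 2 := by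
  revert v
  decide +kernel

theorem prismLineGraph_isArbPartition : IsArbPartition (⊤ : SimpleGraph (Fin 3)) 2
    ((Finset.univ : Finset (Fin 6)).val.map fun k =>
      (⊤ : prismLineGraph.Subgraph).induce (Set.range (prismStar k))) := by
  refine ⟨fun Z hZ => ?_, fun v => ?_⟩
  · obtain ⟨k, -, rfl⟩ := Multiset.mem_map.mp hZ
    exact isCopy_top_induce_range _ (prismStar_adj k)
  · rw [← card_prismStar_incident v, Finset.card_filter, coverM, Multiset.map_map]
    refine Finset.sum_congr rfl fun k _ => ?_
    simp only [Function.comp_apply, SimpleGraph.Subgraph.induce_verts, Set.mem_range]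

/-- There is a finite graph admitting no triangle partition
(no set of vertex-disjoint copies of `K₃` covering every vertex exactly once),
but admitting a collection of triangles covering every vertex exactly twice. -/
theorem statement0 :
    ∃ (V : Type) (_ : Fintype V) (G : SimpleGraph V),
      (¬ ∃ P : Finset G.Subgraph, IsDistPartition (⊤ : SimpleGraph (Fin 3)) 1 P) ∧
      (∃ P : Multiset G.Subgraph, IsArbPartition (⊤ : SimpleGraph (Fin 3)) 2 P) :=
  ⟨Fin 9, inferInstance, prismLineGraph,
    fun ⟨P, hP⟩ => prismLineGraph_not_isDistPartition P hP, _, prismLineGraph_isArbPartition⟩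
end

section
/- Let c ≥ 1 and d ≥ 3 be integers and let H = K_d. Then there exists a (c,H)-coherent gadget G with exactly 2 portal vertices that strictly (c,H)-realizes the relation NEQ_c = { (x, c−x) : 0 ≤ x ≤ c } ⊆ {0,...,c}^2. -/
/-! Framework: copies of `H`, (c,H)-packings and partitions, gadgets,
coherence, and realization of relations, following the paper's definitions. -/

open scoped Classical

namespace NEQGadget

/-- The vertices: `c = m + 1` vertices of each of the `d` colours, and one additional vertex of
colour `0`. -/
abbrev Vert (d m : ℕ) : Type := (Fin d × Fin (m + 1)) ⊕ Unit

/-- The colour of a vertex. -/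
def col {d m : ℕ} [NeZero d] : Vert d m → Fin d
  | .inl a => a.1
  | .inr _ => 0

/-- The complete multipartite graph on the colour classes. -/
def graph (d m : ℕ) [NeZero d] : SimpleGraph (Vert d m) :=
  (⊤ : SimpleGraph (Fin d)).comap col

/-- The two portals, both of colour `0`. -/
def portals (d m : ℕ) [NeZero d] : Fin 2 → Vert d m := ![.inl (0, 0), .inr ()]

variable {d m : ℕ} [NeZero d]

theorem adj_iff {u v : Vert d m} : (graph d m).Adj u v ↔ col u ≠ col v := Iff.rfl

/-- A copy of the complete graph `K_d` meets every colour class exactly once. -/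
theorem existsUnique_col_of_isCopy {Z : (graph d m).Subgraph}
    (hZ : IsCopy (⊤ : SimpleGraph (Fin d)) Z) (k : Fin d) :
    ∃! v, v ∈ Z.verts ∧ col v = k := by
  obtain ⟨φ⟩ := hZ
  have hadj : ∀ a b : Z.verts, a ≠ b → col a.1 ≠ col b.1 := fun a b hab =>
    Z.adj_sub (φ.map_adj_iff.1 ((SimpleGraph.top_adj _ _).2 (φ.injective.ne hab)))
  have hinj : Function.Injective fun j : Fin d => col (φ.symm j).1 := by
    intro i j hij
    by_contra hne
    exact hadj _ _ (φ.symm.injective.ne hne) hij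
  obtain ⟨j, hj⟩ := Finite.surjective_of_injective hinj k
  refine ⟨(φ.symm j).1, ⟨(φ.symm j).2, hj⟩, fun v hv => ?_⟩
  by_contra hne
  refine hadj ⟨v, hv.1⟩ (φ.symm j) (fun h => hne (congrArg Subtype.val h)) ?_
  exact hv.2.trans hj.symm

/-- Every colour class is covered as many times as there are members of the packing. -/
theorem sum_coverM_col (P : Multiset (graph d m).Subgraph)
    (hP : ∀ Z ∈ P, IsCopy (⊤ : SimpleGraph (Fin d)) Z) (k : Fin d) :
    ∑ v, (if col v = k then coverM P v else 0) = P.card := by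
  induction P using Multiset.induction_on with
  | empty => simp [coverM]
  | cons Z P ih =>
    have h1 : ∑ v, (if col v = k ∧ v ∈ Z.verts then 1 else 0) = 1 := by
      obtain ⟨w, hw, hu⟩ := existsUnique_col_of_isCopy (hP Z (Multiset.mem_cons_self _ _)) k
      rw [Finset.sum_eq_single w]
      · simp [hw.1, hw.2]
      · intro v _ hv
        exact if_neg fun h => hv (hu v ⟨h.2, h.1⟩)
      · simp
    rw [Multiset.card_cons, ← ih fun Y hY => hP Y (Multiset.mem_cons_of_mem hY)]
    refine Eq.trans ?_ (congrArg _ h1)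
    rw [← Finset.sum_add_distrib]
    refine Finset.sum_congr rfl fun v _ => ?_
    by_cases hv : col v = k <;> simp [coverM, hv, add_comm]

/-- The sections of `col` used to build packings: the pair `(i, j)` is recorded by the vertices of
the colours other than `0`. -/
def transversal (x : ℕ) (ij : Fin (m + 1) × Fin (m + 1)) (k : Fin d) : Vert d m :=
  if k = 0 then (if ij.1 = 0 ∧ x ≤ ij.2 then .inr () else .inl (0, ij.1))
  else if k = 1 then .inl (1, ij.1) else .inl (k, ij.2)

theorem col_transversal (x : ℕ) (ij : Fin (m + 1) × Fin (m + 1)) (k : Fin d) :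
    col (transversal x ij k) = k := by
  unfold transversal
  split_ifs <;> simp_all [col]

/-- The clique spanned by a transversal. -/
def clique (x : ℕ) (ij : Fin (m + 1) × Fin (m + 1)) : (graph d m).Subgraph :=
  (⊤ : (graph d m).Subgraph).induce (Set.range (transversal x ij))

theorem mem_clique_verts (x : ℕ) (ij : Fin (m + 1) × Fin (m + 1)) (v : Vert d m) :
    v ∈ (clique x ij).verts ↔ transversal x ij (col v) = v := by
  constructor
  · rintro ⟨k, rfl⟩
    rw [col_transversal]
  · exact fun h => ⟨_, h⟩

theorem isCopy_clique (x : ℕ) (ij : Fin (m + 1) × Fin (m + 1)) :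
    IsCopy (⊤ : SimpleGraph (Fin d)) (clique (d := d) x ij) := by
  have hinj : Function.Injective (transversal (d := d) x ij) :=
    Function.LeftInverse.injective (g := col) (col_transversal x ij)
  refine ⟨SimpleGraph.Iso.symm ⟨Equiv.ofInjective _ hinj, ?_⟩⟩
  intro a b
  change (clique x ij).Adj (transversal x ij a) (transversal x ij b) ↔ _
  simp [clique, adj_iff, col_transversal]

theorem clique_injective (hd : 3 ≤ d) (x : ℕ) :
    Function.Injective (clique (d := d) (m := m) x) := by
  obtain ⟨e, rfl⟩ := Nat.exists_eq_add_of_le' hd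
  have h20 : (2 : Fin (e + 3)) ≠ 0 := by
    simp [Fin.ext_iff, Nat.mod_eq_of_lt (show 2 < e + 3 by omega)]
  have h21 : (2 : Fin (e + 3)) ≠ 1 := by
    simp [Fin.ext_iff, Nat.mod_eq_of_lt (show 2 < e + 3 by omega)]
  intro a b hab
  have key : ∀ k : Fin (e + 3), transversal x b k = transversal x a k := fun k => by
    have h : transversal x a k ∈ (clique x b).verts := hab ▸ ⟨k, rfl⟩
    rwa [mem_clique_verts, col_transversal] at h
  have h1 := key 1
  have h2 := key 2
  simp [transversal, h20, h21] at h1 h2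
  exact Prod.ext h1.symm h2.symm

/-- The packing of all cliques spanned by transversals. -/
noncomputable def packing (d m : ℕ) [NeZero d] (x : ℕ) : Finset (graph d m).Subgraph :=
  Finset.univ.image (clique x)

theorem coverF_packing (hd : 3 ≤ d) (x : ℕ) (v : Vert d m) :
    coverF (packing d m x) v = ∑ i, ∑ j, if transversal x (i, j) (col v) = v then 1 else 0 := by
  have h : coverF (packing d m x) v
      = ∑ Z ∈ packing d m x, if v ∈ Z.verts then 1 else 0 := rfl
  rw [h, packing, Finset.sum_image (clique_injective hd x).injOn, Fintype.sum_prod_type]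
  simp only [mem_clique_verts]

theorem card_filter_val_lt {n x : ℕ} (hx : x ≤ n) :
    (Finset.univ.filter fun j : Fin n => (j : ℕ) < x).card = x := by
  rw [Fin.card_filter_val_lt, min_eq_right hx]

theorem coverF_packing_inr (hd : 3 ≤ d) (x : ℕ) (hx : x ≤ m + 1) :
    coverF (packing d m x) (.inr ()) = m + 1 - x := by
  have hcard := Finset.card_filter_add_card_filter_not (s := Finset.univ)
    (fun j : Fin (m + 1) => (j : ℕ) < x)
  rw [card_filter_val_lt hx] at hcard
  simp only [not_lt, Finset.card_univ, Fintype.card_fin] at hcard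
  rw [coverF_packing hd, Finset.sum_eq_single 0]
  · simp [transversal, col]
    omega
  · intro i _ hi
    simp [transversal, col, hi]
  · simp

theorem coverF_packing_inl_zero_zero (hd : 3 ≤ d) (x : ℕ) (hx : x ≤ m + 1) :
    coverF (packing d m x) (.inl (0, 0)) = x := by
  rw [coverF_packing hd, Finset.sum_eq_single 0]
  · simp [transversal, col, Fin.card_filter_val_lt, hx]
  · intro i _ hi
    simp [transversal, col, hi]
  · simp

theorem coverF_packing_inl (hd : 3 ≤ d) (x : ℕ) (k : Fin d) (i : Fin (m + 1))
    (hki : (k, i) ≠ (0, 0)) :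
    coverF (packing d m x) (.inl (k, i)) = m + 1 := by
  rw [coverF_packing hd]
  by_cases hk : k = 0
  · subst hk
    have hi : i ≠ 0 := fun h => hki (by rw [h])
    rw [Finset.sum_eq_single i]
    · simp [transversal, col, hi]
    · intro i' _ hi'
      refine Finset.sum_eq_zero fun j _ => if_neg ?_
      by_cases h : i' = 0 ∧ x ≤ (j : ℕ) <;> simp [transversal, col, h, hi']
    · simp
  · by_cases hk1 : k = 1
    · subst hk1
      simp [transversal, col, hk]
    · simp [transversal, col, hk, hk1]

theorem range_portals : Set.range (portals d m) = {.inl (0, 0), .inr ()} := by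
  simp [portals, Set.pair_comm]

theorem coherent (c : ℕ) :
    Coherent (⊤ : SimpleGraph (Fin d)) c (graph d m) (portals d m) := by
  rintro W E ι - - hint P hP Z hZ ⟨v, hv, hvZ⟩ w hw
  by_cases hvw : w = ι v
  · exact ⟨v, hvw.symm⟩
  obtain ⟨φ⟩ := hP.1 Z hZ
  have hadj : Z.coe.Adj ⟨ι v, hvZ⟩ ⟨w, hw⟩ :=
    φ.map_adj_iff.1 ((SimpleGraph.top_adj _ _).2
      (φ.injective.ne fun h => hvw (congrArg Subtype.val h).symm))
  exact hint v hv w (Z.adj_sub hadj)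

/-- Double counting the colours `0` and `1`: the covers of the two portals add up to `c`. -/
theorem coverM_portals_add (hd : 3 ≤ d) (P : Multiset (graph d m).Subgraph)
    (hP : ∀ Z ∈ P, IsCopy (⊤ : SimpleGraph (Fin d)) Z)
    (hint : ∀ v, v ∉ Set.range (portals d m) → coverM P v = m + 1) :
    coverM P (portals d m 0) + coverM P (portals d m 1) = m + 1 := by
  obtain ⟨e, rfl⟩ := Nat.exists_eq_add_of_le' hd
  have hcol : ∀ k, ∑ v, (if col v = k then coverM P v else 0)
      = ∑ i, coverM P (.inl (k, i)) + if 0 = k then coverM P (.inr ()) else 0 := by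
    intro k
    rw [Fintype.sum_sum_type, Fintype.sum_prod_type, Finset.sum_eq_single k]
    · simp [col]
      rfl
    · intro l _ hl
      simp [col, hl]
    · simp
  have h := (sum_coverM_col P hP 0).trans (sum_coverM_col P hP 1).symm
  rw [hcol, hcol, Fin.sum_univ_succ,
    Finset.sum_congr rfl fun i _ => hint (.inl (0, Fin.succ i)) (by simp [range_portals]),
    Finset.sum_congr rfl fun i _ => hint (.inl (1, i)) (by simp [range_portals])] at h
  simp only [Finset.sum_const, Finset.card_univ, Fintype.card_fin, smul_eq_mul, if_true,
    zero_ne_one, if_false] at h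
  change coverM P (.inl (0, 0)) + coverM P (.inr ()) = m + 1
  linarith

theorem packing_spec (hd : 3 ≤ d) {r : Fin 2 → ℕ} (hr : r ∈ NEQrel (m + 1)) :
    (∀ Z ∈ packing d m (r 0), IsCopy (⊤ : SimpleGraph (Fin d)) Z) ∧
      (∀ v, coverF (packing d m (r 0)) v ≤ m + 1) ∧
      (∀ v, v ∉ Set.range (portals d m) → coverF (packing d m (r 0)) v = m + 1) ∧
      ∀ i, coverF (packing d m (r 0)) (portals d m i) = r i := by
  obtain ⟨x, hx, rfl, h1⟩ := hr
  have hint : ∀ v, v ∉ Set.range (portals d m) → coverF (packing d m (r 0)) v = m + 1 := by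
    rintro (⟨k, i⟩ | u) hv
    · exact coverF_packing_inl hd _ k i fun h => hv ⟨0, by rw [h]; rfl⟩
    · exact absurd ⟨1, rfl⟩ hv
  have hport : ∀ i, coverF (packing d m (r 0)) (portals d m i) = r i := by
    rw [Fin.forall_fin_two]
    exact ⟨coverF_packing_inl_zero_zero hd _ hx, (coverF_packing_inr hd _ hx).trans h1.symm⟩
  refine ⟨?_, fun v => ?_, hint, hport⟩
  · intro Z hZ
    obtain ⟨ij, -, rfl⟩ := Finset.mem_image.1 hZ
    exact isCopy_clique _ ij
  · by_cases hv : v ∈ Set.range (portals d m)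
    · obtain ⟨i, rfl⟩ := hv
      rw [hport]
      revert i
      rw [Fin.forall_fin_two]
      omega
    · exact (hint v hv).le

theorem mem_NEQrel_of_packing (hd : 3 ≤ d) {r : Fin 2 → ℕ} (P : Multiset (graph d m).Subgraph)
    (hP : ∀ Z ∈ P, IsCopy (⊤ : SimpleGraph (Fin d)) Z)
    (hint : ∀ v, v ∉ Set.range (portals d m) → coverM P v = m + 1)
    (hport : ∀ i, coverM P (portals d m i) = r i) : r ∈ NEQrel (m + 1) := by
  have h := coverM_portals_add hd P hP hint
  rw [hport, hport] at h
  exact ⟨r 0, by omega, rfl, by omega⟩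

theorem strictRealizes (hd : 3 ≤ d) :
    StrictRealizes (⊤ : SimpleGraph (Fin d)) (m + 1) (graph d m) (portals d m)
      (NEQrel (m + 1)) := by
  refine ⟨fun r _ => ⟨fun hr => ⟨_, packing_spec hd hr⟩, ?_⟩,
    fun r _ => ⟨fun hr => ⟨(packing d m (r 0)).val, packing_spec hd hr⟩, ?_⟩⟩
  · rintro ⟨P, hP, -, hint, hport⟩
    exact mem_NEQrel_of_packing hd P.val hP hint hport
  · rintro ⟨P, hP, -, hint, hport⟩
    exact mem_NEQrel_of_packing hd P hP hint hport

end NEQGadget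

/-- For `c ≥ 1`, `d ≥ 3` and `H = K_d` there is a `(c,H)`-coherent
gadget with exactly two portal vertices strictly `(c,H)`-realizing `NEQ_c`. -/
theorem statement2 (c d : ℕ) (hc : 1 ≤ c) (hd : 3 ≤ d) :
    ∃ (V : Type) (_ : Fintype V) (G : SimpleGraph V) (portals : Fin 2 → V),
      Function.Injective portals ∧
      Coherent (⊤ : SimpleGraph (Fin d)) c G portals ∧
      StrictRealizes (⊤ : SimpleGraph (Fin d)) c G portals (NEQrel c) := by
  obtain ⟨m, rfl⟩ := Nat.exists_eq_add_of_le' hc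
  have : NeZero d := ⟨by omega⟩
  refine ⟨NEQGadget.Vert d m, inferInstance, NEQGadget.graph d m, NEQGadget.portals d m, ?_,
    NEQGadget.coherent _, NEQGadget.strictRealizes hd⟩
  intro i j
  fin_cases i <;> fin_cases j <;> simp [NEQGadget.portals]
end

section
/- Let c ≥ 1 and d ≥ 3 be integers and let H = K_d. Then there exists a (c,H)-coherent gadget G with exactly d portal vertices that strictly (c,H)-realizes the equality relation EQ = { (x, x, ..., x) ∈ {0,...,c}^d : 0 ≤ x ≤ c }. -/
/-! Framework: copies of `H`, (c,H)-packings and partitions, gadgets,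
coherence, and realization of relations, following the paper's definitions. -/

open scoped Classical

/-- The gadget graph: the vertices `(i, k)` with `k ≠ 0` form a clique (the hub `i`), and each
independent vertex `(j, 0)` is joined to all vertices of all hubs. -/
def hubGraph (c m : ℕ) : SimpleGraph (Fin (c + 1) × Fin (m + 2)) where
  Adj v w := v.2 ≠ w.2 ∧ (v.1 = w.1 ∨ v.2 = 0 ∨ w.2 = 0)
  symm := ⟨fun _ _ h => ⟨h.1.symm, h.2.elim (fun e => .inl e.symm) fun e => .inr e.symm⟩⟩
  loopless := ⟨fun _ h => h.1 rfl⟩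

/-- Any two vertices of a copy of a complete graph are adjacent. -/
lemma IsCopy.adj_of_mem {α V : Type} {G : SimpleGraph V} {Z : G.Subgraph}
    (hZ : IsCopy (⊤ : SimpleGraph α) Z) {v w : V} (hv : v ∈ Z.verts) (hw : w ∈ Z.verts)
    (hne : v ≠ w) : G.Adj v w := by
  obtain ⟨f⟩ := hZ
  have h : Z.coe.Adj ⟨v, hv⟩ ⟨w, hw⟩ := by
    rw [← f.map_adj_iff, SimpleGraph.top_adj]
    exact fun h => hne (congrArg Subtype.val (f.injective h))
  exact Z.adj_sub h

/-- Complete subgraphs through internal vertices never leave a gadget. -/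
lemma coherent_top {α V : Type} (c : ℕ) {ℓ : ℕ} (G : SimpleGraph V) (portals : Fin ℓ → V) :
    Coherent (⊤ : SimpleGraph α) c G portals := by
  rintro W E ι - - hint P hP Z hZ ⟨v, hv, hvZ⟩ w hw
  by_cases h : ι v = w
  · exact ⟨v, h⟩
  · exact hint v hv w ((hP.1 Z hZ).adj_of_mem hvZ hw h)

/-- A copy of `K_(m+2)` in the gadget meets every column exactly once. -/
lemma IsCopy.existsUnique_row {c m : ℕ} {Z : (hubGraph c m).Subgraph}
    (hZ : IsCopy (⊤ : SimpleGraph (Fin (m + 2))) Z) (k : Fin (m + 2)) :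
    ∃! i, (i, k) ∈ Z.verts := by
  have hinj : ∀ v ∈ Z.verts, ∀ w ∈ Z.verts, v.2 = w.2 → v = w := fun v hv w hw h => by
    by_contra hne
    exact (hZ.adj_of_mem hv hw hne).1 h
  obtain ⟨f⟩ := hZ
  have hg : Function.Injective fun n => (f.symm n : Fin (c + 1) × Fin (m + 2)).2 :=
    fun a b h => f.symm.injective (Subtype.ext (hinj _ (f.symm a).2 _ (f.symm b).2 h))
  obtain ⟨n, rfl⟩ := Finite.surjective_of_injective hg k
  exact ⟨_, (f.symm n).2, fun i hi => congrArg Prod.fst (hinj _ hi _ (f.symm n).2 rfl)⟩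

/-- A copy of `K_(m+2)` in the gadget contains either all of a hub or none of it. -/
lemma IsCopy.mem_hub {c m : ℕ} {Z : (hubGraph c m).Subgraph}
    (hZ : IsCopy (⊤ : SimpleGraph (Fin (m + 2))) Z) {k l : Fin (m + 2)} (hk : k ≠ 0) (hl : l ≠ 0)
    {i : Fin (c + 1)} (h : (i, k) ∈ Z.verts) : (i, l) ∈ Z.verts := by
  obtain ⟨j, hj, -⟩ := hZ.existsUnique_row l
  by_cases hne : (i, k) = (j, l)
  · simp only [Prod.mk.injEq] at hne
    rwa [hne.1]
  · have := (hZ.adj_of_mem h hj hne).2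
    simp only [hk, hl, or_false] at this
    rwa [this]

lemma coverM_zero {V : Type} {G : SimpleGraph V} (v : V) :
    coverM (0 : Multiset G.Subgraph) v = 0 := rfl

lemma coverM_cons {V : Type} {G : SimpleGraph V} (Z : G.Subgraph) (P : Multiset G.Subgraph)
    (v : V) : coverM (Z ::ₘ P) v = (if v ∈ Z.verts then 1 else 0) + coverM P v := by
  simp [coverM]

/-- The total cover of every column is the number of copies. -/
lemma sum_coverM_column {c m : ℕ} (P : Multiset (hubGraph c m).Subgraph)
    (hP : ∀ Z ∈ P, IsCopy (⊤ : SimpleGraph (Fin (m + 2))) Z) (k : Fin (m + 2)) :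
    ∑ i, coverM P (i, k) = Multiset.card P := by
  induction P using Multiset.induction_on with
  | empty => simp [coverM_zero]
  | cons Z P ih =>
    obtain ⟨i, hi, hu⟩ := (hP Z (Multiset.mem_cons_self _ _)).existsUnique_row k
    have hrow : ∀ j, (j, k) ∈ Z.verts ↔ j = i := fun j => ⟨hu j, by rintro rfl; exact hi⟩
    simp only [coverM_cons, Finset.sum_add_distrib, hrow,
      ih fun Y hY => hP Y (Multiset.mem_cons_of_mem hY)]
    simp [add_comm]

/-- If all internal vertices of the gadget are covered `c` times, then all portals are covered
equally often. -/
lemma coverM_portal_eq {c m : ℕ} (P : Multiset (hubGraph c m).Subgraph)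
    (hP : ∀ Z ∈ P, IsCopy (⊤ : SimpleGraph (Fin (m + 2))) Z)
    (hint : ∀ i ≠ 0, ∀ k, coverM P (i, k) = c) (k : Fin (m + 2)) :
    coverM P (0, k) = coverM P (0, 0) := by
  have h := (sum_coverM_column P hP k).trans (sum_coverM_column P hP 0).symm
  rw [Fin.sum_univ_succ, Fin.sum_univ_succ] at h
  simpa [hint _ (Fin.succ_ne_zero _)] using h

/-- The clique consisting of hub `p.1` and the independent vertex `(p.2, 0)`. -/
def hubClique {c : ℕ} (m : ℕ) (p : Fin (c + 1) × Fin (c + 1)) : (hubGraph c m).Subgraph :=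
  (⊤ : (hubGraph c m).Subgraph).induce {v | v.1 = if v.2 = 0 then p.2 else p.1}

lemma isCopy_hubClique {c m : ℕ} (p : Fin (c + 1) × Fin (c + 1)) :
    IsCopy (⊤ : SimpleGraph (Fin (m + 2))) (hubClique m p) := by
  refine ⟨⟨⟨fun v => v.1.2, fun k => ⟨(if k = 0 then p.2 else p.1, k), rfl⟩, ?_, ?_⟩, ?_⟩⟩
  · rintro ⟨⟨i, k⟩, h⟩
    exact Subtype.ext (Prod.ext (Eq.symm h) rfl)
  · exact fun k => rfl
  · rintro ⟨⟨i, k⟩, h⟩ ⟨⟨j, l⟩, h'⟩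
    have hi : i = if k = 0 then p.2 else p.1 := h
    have hj : j = if l = 0 then p.2 else p.1 := h'
    have hor : i = j ∨ k = 0 ∨ l = 0 := by
      by_cases hk : k = 0 <;> by_cases hl : l = 0 <;> simp_all
    exact ⟨fun hne => ⟨h, h', hne, hor⟩, fun hadj => hadj.2.2.1⟩

lemma hubClique_injective {c m : ℕ} :
    Function.Injective (hubClique (c := c) m) := by
  intro p q h
  have hv : ∀ v : Fin (c + 1) × Fin (m + 2), (v.1 = if v.2 = 0 then p.2 else p.1) ↔
      (v.1 = if v.2 = 0 then q.2 else q.1) := fun v =>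
    Set.ext_iff.mp (congrArg SimpleGraph.Subgraph.verts h) v
  exact Prod.ext (by simpa using hv (p.1, 1)) (by simpa using hv (p.2, 0))

/-- The hub–vertex pairs used to cover the portals `x` times and everything else `c` times. -/
def UsedPair {c : ℕ} (x i j : Fin (c + 1)) : Prop :=
  ¬(i = j ∧ i ≤ x) ∧ ¬(i = 0 ∧ x < j) ∧ ¬(j = 0 ∧ x < i)

lemma usedPair_comm {c : ℕ} (x i j : Fin (c + 1)) : UsedPair x i j ↔ UsedPair x j i := by
  unfold UsedPair
  grind

lemma card_usedPair {c : ℕ} (x i : Fin (c + 1)) :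
    (Finset.univ.filter fun j => UsedPair x i j).card = if i = 0 then x.val else c := by
  split_ifs with hi
  · have : (Finset.univ.filter fun j => UsedPair x i j) = Finset.Ioc 0 x := by
      ext j
      simp only [UsedPair, Finset.mem_Ioc]
      grind
    simp [this]
  · have : (Finset.univ.filter fun j => UsedPair x i j) =
        Finset.univ.erase (if i ≤ x then i else 0) := by
      ext j
      simp only [UsedPair, Finset.mem_univ, Finset.mem_erase]
      grind
    simp [this]

/-- The cliques of the used pairs. -/
noncomputable def usedCliques {c : ℕ} (m : ℕ) (x : Fin (c + 1)) : Finset (hubGraph c m).Subgraph :=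
  (Finset.univ.filter fun p : Fin (c + 1) × Fin (c + 1) => UsedPair x p.1 p.2).image (hubClique m)

lemma coverF_usedCliques {c m : ℕ} (x i : Fin (c + 1)) (k : Fin (m + 2)) :
    coverF (usedCliques m x) (i, k) = if i = 0 then x.val else c := by
  have h : coverF (usedCliques m x) (i, k) =
      ∑ Z ∈ usedCliques m x, if (i, k) ∈ Z.verts then 1 else 0 := rfl
  rw [h, usedCliques, Finset.sum_image hubClique_injective.injOn, Finset.sum_filter,
    Fintype.sum_prod_type]
  have hmem : ∀ p : Fin (c + 1) × Fin (c + 1),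
      (i, k) ∈ (hubClique m p).verts ↔ i = if k = 0 then p.2 else p.1 := fun p => Iff.rfl
  simp only [hmem]
  by_cases hk : k = 0
  · rw [Finset.sum_congr rfl fun a _ => Finset.sum_congr rfl fun b _ => by rw [if_pos hk],
      Finset.sum_comm, Finset.sum_eq_single i (by grind [Finset.sum_eq_zero]) (by simp)]
    simp only [if_true, usedPair_comm x _ i, ← Finset.card_filter, card_usedPair]
  · rw [Finset.sum_congr rfl fun a _ => Finset.sum_congr rfl fun b _ => by rw [if_neg hk],
      Finset.sum_eq_single i (by grind [Finset.sum_eq_zero]) (by simp)]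
    simp only [if_true, ← Finset.card_filter, card_usedPair]

/-- For `c ≥ 1`, `d ≥ 3` and `H = K_d` there is a `(c,H)`-coherent
gadget with exactly `d` portal vertices strictly `(c,H)`-realizing the equality relation
`EQ = {(x,…,x) : 0 ≤ x ≤ c}`. -/
theorem statement3 (c d : ℕ) (hc : 1 ≤ c) (hd : 3 ≤ d) :
    ∃ (V : Type) (_ : Fintype V) (G : SimpleGraph V) (portals : Fin d → V),
      Function.Injective portals ∧
      Coherent (⊤ : SimpleGraph (Fin d)) c G portals ∧
      StrictRealizes (⊤ : SimpleGraph (Fin d)) c G portals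
        {r : Fin d → ℕ | ∃ x ≤ c, ∀ i, r i = x} := by
  obtain ⟨m, rfl⟩ : ∃ m, d = m + 2 := ⟨d - 2, by omega⟩
  have hrange : ∀ v : Fin (c + 1) × Fin (m + 2),
      v ∉ Set.range (fun k : Fin (m + 2) => ((0 : Fin (c + 1)), k)) ↔ v.1 ≠ 0 := by
    rintro ⟨i, k⟩
    simp [eq_comm]
  have hexists : ∀ r : Fin (m + 2) → ℕ, (∃ x ≤ c, ∀ i, r i = x) →
      ∃ P : Finset (hubGraph c m).Subgraph,
        (∀ Z ∈ P, IsCopy (⊤ : SimpleGraph (Fin (m + 2))) Z) ∧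
        (∀ v, coverF P v ≤ c) ∧
        (∀ v, v ∉ Set.range (fun k : Fin (m + 2) => ((0 : Fin (c + 1)), k)) → coverF P v = c) ∧
        ∀ k, coverF P (0, k) = r k := by
    rintro r ⟨x, hx, hr⟩
    refine ⟨usedCliques m ⟨x, by omega⟩, fun Z hZ => ?_, fun v => ?_, fun v hv => ?_, fun k => ?_⟩
    · obtain ⟨p, -, rfl⟩ := Finset.mem_image.mp hZ
      exact isCopy_hubClique p
    · rw [coverF_usedCliques]
      split_ifs <;> simp [hx]
    · rw [coverF_usedCliques, if_neg ((hrange v).mp hv)]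
    · rw [coverF_usedCliques, if_pos rfl, hr]
  have hequal : ∀ r : Fin (m + 2) → ℕ, (∀ i, r i ≤ c) → ∀ P : Multiset (hubGraph c m).Subgraph,
      (∀ Z ∈ P, IsCopy (⊤ : SimpleGraph (Fin (m + 2))) Z) →
      (∀ v, v ∉ Set.range (fun k : Fin (m + 2) => ((0 : Fin (c + 1)), k)) → coverM P v = c) →
      (∀ k, coverM P (0, k) = r k) → ∃ x ≤ c, ∀ i, r i = x := by
    intro r hr P hP hint hcov
    refine ⟨r 0, hr 0, fun k => ?_⟩
    rw [← hcov, ← hcov]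
    exact coverM_portal_eq P hP (fun i hi k => hint (i, k) ((hrange _).mpr hi)) k
  refine ⟨Fin (c + 1) × Fin (m + 2), inferInstance, hubGraph c m, fun k => (0, k),
    Prod.mk_right_injective 0, coherent_top c _ _, fun r hr => ⟨hexists r, ?_⟩,
    fun r hr => ⟨fun h => ?_, ?_⟩⟩
  · rintro ⟨P, hP, -, hint, hcov⟩
    exact hequal r hr P.val hP hint hcov
  · obtain ⟨P, hP⟩ := hexists r h
    exact ⟨P.val, hP⟩
  · rintro ⟨P, hP, -, hint, hcov⟩
    exact hequal r hr P hP hint hcov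
end

section
/- Let c ≥ 2 and d ≥ 3 be integers, let H = K_d, and let k ≥ 1 be an integer. Then there exists a gadget G with exactly k·d portal vertices that strictly (c,H)-realizes the single-tuple relation COVER = { (c−1, c−1, ..., c−1) } ⊆ {0,...,c}^{k·d}. -/
/-! Framework: copies of `H`, (c,H)-packings and partitions, gadgets,
coherence, and realization of relations, following the paper's definitions. -/

open scoped Classical

/-! The gadget is built from a `d`-uniform conformal hypergraph: the copies of `K_d` in the graph
joining vertices of a common hyperedge are exactly the hyperedges, so packings become
multiplicity functions on hyperedges. -/

section Hypergraph

variable {V E : Type}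

/-- The graph joining two distinct vertices when they lie in a common hyperedge; `inc v e` says
that the vertex `v` lies in the hyperedge `e`. -/
def incGraph (inc : V → E → Prop) : SimpleGraph V where
  Adj u v := u ≠ v ∧ ∃ e, inc u e ∧ inc v e
  symm := ⟨fun _ _ h => ⟨h.1.symm, h.2.imp fun _ he => he.symm⟩⟩
  loopless := ⟨fun _ h => h.1 rfl⟩

/-- The complete subgraph spanned by a hyperedge. -/
def edgeCopy (inc : V → E → Prop) (e : E) : (incGraph inc).Subgraph :=
  (⊤ : (incGraph inc).Subgraph).induce {v | inc v e}

/-- Every set of pairwise co-incident vertices is contained in a hyperedge. -/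
def IsConformal (inc : V → E → Prop) : Prop :=
  ∀ s : Set V, (∀ u ∈ s, ∀ v ∈ s, ∃ e, inc u e ∧ inc v e) → ∃ e, ∀ v ∈ s, inc v e

theorem edgeCopy_injective {inc : V → E → Prop}
    (hinj : Function.Injective fun e => {v | inc v e}) : Function.Injective (edgeCopy inc) :=
  fun _ _ h => hinj (congrArg SimpleGraph.Subgraph.verts h)

theorem isCopy_edgeCopy [Finite V] {inc : V → E → Prop} {d : ℕ} {e : E}
    (hcard : {v | inc v e}.ncard = d) : IsCopy (⊤ : SimpleGraph (Fin d)) (edgeCopy inc e) := by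
  have hc : Nat.card (edgeCopy inc e).verts = d := hcard
  refine ⟨⟨Finite.equivFinOfCardEq hc, ?_⟩⟩
  intro u v
  rw [SimpleGraph.top_adj, (Finite.equivFinOfCardEq hc).injective.ne_iff, ← Subtype.coe_ne_coe]
  exact ⟨fun h => ⟨u.2, v.2, h, e, u.2, v.2⟩, fun h => h.2.2.1⟩

theorem exists_eq_edgeCopy [Finite V] {inc : V → E → Prop} {d : ℕ} (hd : 2 ≤ d)
    (hcard : ∀ e, {v | inc v e}.ncard = d) (hconf : IsConformal inc) {Z : (incGraph inc).Subgraph}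
    (hZ : IsCopy (⊤ : SimpleGraph (Fin d)) Z) : ∃ e, edgeCopy inc e = Z := by
  obtain ⟨φ⟩ := hZ
  have hadj : ∀ u ∈ Z.verts, ∀ v ∈ Z.verts, u ≠ v → Z.Adj u v := by
    intro u hu v hv huv
    have h : Z.coe.Adj ⟨u, hu⟩ ⟨v, hv⟩ := by
      rw [← φ.map_adj_iff, SimpleGraph.top_adj]
      simpa using huv
    exact h
  have hZcard : Z.verts.ncard = d := by
    rw [← Nat.card_coe_set_eq, Nat.card_congr φ.toEquiv, Nat.card_fin]
  have hnt : Z.verts.Nontrivial := (Set.one_lt_ncard_iff_nontrivial).1 (by omega)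
  obtain ⟨e, he⟩ := hconf Z.verts (by
    intro u hu v hv
    by_cases huv : u = v
    · subst huv
      obtain ⟨w, hw, hwu⟩ := hnt.exists_ne u
      obtain ⟨-, e, he, -⟩ := (hadj u hu w hw hwu.symm).adj_sub
      exact ⟨e, he, he⟩
    · exact (hadj u hu v hv huv).adj_sub.2)
  have hverts : Z.verts = {v | inc v e} :=
    Set.eq_of_subset_of_ncard_le he (by rw [hcard, hZcard])
  refine ⟨e, SimpleGraph.Subgraph.ext hverts.symm ?_⟩
  ext u v
  constructor
  · rintro ⟨hu, hv, huv⟩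
    rw [← hverts] at hu hv
    exact hadj u hu v hv huv.ne
  · intro h
    exact ⟨hverts ▸ Z.edge_vert h, hverts ▸ Z.edge_vert h.symm, h.adj_sub⟩

theorem coverM_map_edgeCopy [Fintype E] (inc : V → E → Prop) (P : Multiset E) (v : V) :
    coverM (P.map (edgeCopy inc)) v = ∑ e, if inc v e then P.count e else 0 := by
  have h : coverM (P.map (edgeCopy inc)) v = (P.map fun e => if inc v e then 1 else 0).sum := by
    rw [coverM, Multiset.map_map]
    rfl
  rw [h, Finset.sum_multiset_map_count]
  refine (Finset.sum_subset (Finset.subset_univ _) fun e _ he => ?_).trans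
    (Finset.sum_congr rfl fun e _ => ?_)
  · rw [Multiset.count_eq_zero_of_notMem (by simpa using he), zero_smul]
  · split_ifs <;> simp

/-- A conformal `d`-uniform hypergraph with all internal degrees `c` and all portal degrees `c - 1`
yields a gadget for `COVER`, provided every multiplicity function covering the internal vertices
exactly `c` times covers the portals exactly `c - 1` times. -/
theorem strictRealizes_incGraph [Finite V] [Fintype E] {inc : V → E → Prop} {c d ℓ : ℕ}
    {portals : Fin ℓ → V} (hd : 2 ≤ d)
    (hcard : ∀ e, {v | inc v e}.ncard = d) (hconf : IsConformal inc)
    (hinj : Function.Injective fun e => {v | inc v e})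
    (hinternal : ∀ v, v ∉ Set.range portals → (∑ e, if inc v e then 1 else 0) = c)
    (hport : ∀ i, (∑ e, if inc (portals i) e then 1 else 0) = c - 1)
    (hforce : ∀ m : E → ℕ,
      (∀ v, v ∉ Set.range portals → (∑ e, if inc v e then m e else 0) = c) →
      ∀ i, (∑ e, if inc (portals i) e then m e else 0) = c - 1) :
    StrictRealizes (⊤ : SimpleGraph (Fin d)) c (incGraph inc) portals
      {r | ∀ i, r i = c - 1} := by
  have hback : ∀ (r : Fin ℓ → ℕ) (P : Multiset (incGraph inc).Subgraph),
      (∀ Z ∈ P, IsCopy (⊤ : SimpleGraph (Fin d)) Z) →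
      (∀ v, v ∉ Set.range portals → coverM P v = c) →
      (∀ i, coverM P (portals i) = r i) → ∀ i, r i = c - 1 := by
    intro r P hP hv hr i
    obtain ⟨Q, rfl⟩ : ∃ Q : Multiset E, Q.map (edgeCopy inc) = P := by
      have : Nonempty E := ⟨(hconf ∅ (by simp)).choose⟩
      choose! f hf using fun Z hZ => exists_eq_edgeCopy hd hcard hconf (hP Z hZ)
      exact ⟨P.map f, by
        rw [Multiset.map_map]
        exact (Multiset.map_congr rfl hf).trans (Multiset.map_id' P)⟩
    simp only [coverM_map_edgeCopy] at hv hr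
    rw [← hr i]
    exact hforce _ hv i
  let F : Finset (incGraph inc).Subgraph :=
    Finset.univ.map ⟨edgeCopy inc, edgeCopy_injective hinj⟩
  have hF : ∀ v, coverM F.val v = ∑ e, if inc v e then 1 else 0 := by
    intro v
    have h : F.val = (Finset.univ : Finset E).val.map (edgeCopy inc) := rfl
    rw [h, coverM_map_edgeCopy]
    simp [Multiset.count_eq_one_of_mem Finset.univ.nodup]
  have hFcopy : ∀ Z ∈ F, IsCopy (⊤ : SimpleGraph (Fin d)) Z := by
    intro Z hZ
    obtain ⟨e, -, rfl⟩ := Finset.mem_map.1 hZ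
    exact isCopy_edgeCopy (hcard e)
  have hFint : ∀ v, v ∉ Set.range portals → coverM F.val v = c := fun v hv =>
    (hF v).trans (hinternal v hv)
  have hFport : ∀ i, coverM F.val (portals i) = c - 1 := fun i => (hF _).trans (hport i)
  have hFle : ∀ v, coverM F.val v ≤ c := by
    intro v
    by_cases hv : v ∈ Set.range portals
    · obtain ⟨i, rfl⟩ := hv
      rw [hFport]
      omega
    · exact (hFint v hv).le
  constructor <;> intro r _ <;> constructor
  · intro hr
    exact ⟨F, hFcopy, hFle, hFint, fun i => (hFport i).trans (hr i).symm⟩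
  · rintro ⟨P, hP, -, hv, hr⟩
    exact hback r P.val hP hv hr
  · intro hr
    exact ⟨F.val, hFcopy, hFle, hFint, fun i => (hFport i).trans (hr i).symm⟩
  · rintro ⟨P, hP, -, hv, hr⟩
    exact hback r P hP hv hr

/-- Incidence in the disjoint union of `ι` copies of a hypergraph. -/
def copies (ι : Type) (inc : V → E → Prop) (v : ι × V) (e : ι × E) : Prop :=
  v.1 = e.1 ∧ inc v.2 e.2

variable {ι : Type} {inc : V → E → Prop}

theorem setOf_copies (e : ι × E) :
    {v | copies ι inc v e} = Prod.mk e.1 '' {v | inc v e.2} := by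
  ext ⟨i, v⟩
  simp [copies, and_comm, eq_comm]

theorem ncard_copies (e : ι × E) :
    {v | copies ι inc v e}.ncard = {v | inc v e.2}.ncard := by
  rw [setOf_copies, Set.ncard_image_of_injective _ (Prod.mk_right_injective _)]

theorem IsConformal.copies [Nonempty ι] (hconf : IsConformal inc) : IsConformal (copies ι inc) := by
  intro s hs
  obtain rfl | ⟨u, hu⟩ := s.eq_empty_or_nonempty
  · obtain ⟨e, -⟩ := hconf ∅ (by simp)
    exact ⟨(Classical.arbitrary ι, e), by simp⟩
  have hfst : ∀ v ∈ s, v.1 = u.1 := by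
    intro v hv
    obtain ⟨e, he, he'⟩ := hs v hv u hu
    exact he.1.trans he'.1.symm
  obtain ⟨e, he⟩ := hconf (Prod.snd '' s) (by
    rintro _ ⟨v, hv, rfl⟩ _ ⟨w, hw, rfl⟩
    obtain ⟨e, he, he'⟩ := hs v hv w hw
    exact ⟨e.2, he.2, he'.2⟩)
  exact ⟨(u.1, e), fun v hv => ⟨hfst v hv, he _ ⟨v, hv, rfl⟩⟩⟩

theorem copies_injective (hne : ∀ e, {v | inc v e}.Nonempty)
    (hinj : Function.Injective fun e => {v | inc v e}) :
    Function.Injective fun e => {v | copies ι inc v e} := by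
  rintro ⟨i, e⟩ ⟨j, f⟩ h
  simp only [Set.ext_iff, Set.mem_ofPred_eq, copies, Prod.forall] at h
  obtain ⟨v, hv⟩ := hne e
  obtain rfl : i = j := ((h i v).1 ⟨rfl, hv⟩).1
  have : e = f := hinj (Set.ext fun w => by simpa using h i w)
  rw [this]

theorem sum_copies [Fintype ι] [Fintype E] (m : ι × E → ℕ) (v : ι × V) :
    (∑ e, if copies ι inc v e then m e else 0) = ∑ e, if inc v.2 e then m (v.1, e) else 0 := by
  rw [Fintype.sum_prod_type, Finset.sum_eq_single v.1]
  · simp [copies]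
  · intro j _ hj
    simp [copies, hj.symm]
  · simp

end Hypergraph

section Cover

/-- Vertices of the hypergraph for `c = a + 1` and `d = D + 2`. For each layer `n`, the vertices
`row n i` and `tip n` form a clique of size `d - 1`. -/
inductive CoverVertex (a D : ℕ) : Type
  | hub (b : Fin 2) (x : Fin a)
  | row (n : Fin (2 * a + 2)) (i : Fin D)
  | tip (n : Fin (2 * a + 2))
  | apex (b : Fin 2)

noncomputable instance (a D : ℕ) : Fintype (CoverVertex a D) :=
  Fintype.ofSurjective
    (Sum.elim (fun p : Fin 2 × Fin a => .hub p.1 p.2)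
      (Sum.elim (fun p : Fin (2 * a + 2) × Fin D => .row p.1 p.2)
        (Sum.elim CoverVertex.tip CoverVertex.apex))) (by
    rintro (⟨b, x⟩ | ⟨n, i⟩ | n | b)
    · exact ⟨.inl (b, x), rfl⟩
    · exact ⟨.inr (.inl (n, i)), rfl⟩
    · exact ⟨.inr (.inr (.inl n)), rfl⟩
    · exact ⟨.inr (.inr (.inr b)), rfl⟩)

/-- Hyperedges: `inl (n, x)` joins the layer `n` to a hub of the parity of `n`, and `inr n` joins
`row n` to the tip of the layer `n + 1` and the apex of the parity of `n`. -/
abbrev CoverEdge (a : ℕ) : Type := Fin (2 * a + 2) × Fin a ⊕ Fin (2 * a + 1)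

variable {a D : ℕ}

/-- Incidence of the hypergraph with vertices `CoverVertex` and hyperedges `CoverEdge`. -/
def coverInc : CoverVertex a D → CoverEdge a → Prop
  | .hub b x, .inl e => (e.1 : ℕ) % 2 = b ∧ x = e.2
  | .row n _, .inl e => n = e.1
  | .tip n, .inl e => n = e.1
  | .apex _, .inl _ => False
  | .hub _ _, .inr _ => False
  | .row n _, .inr e => (n : ℕ) = e
  | .tip n, .inr e => (n : ℕ) = e + 1
  | .apex b, .inr e => (e : ℕ) % 2 = b

/-- The `D + 2` vertices of the hypergraph lying in one hyperedge less than the others. -/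
def coverPortal : Option (Option (Fin D)) → CoverVertex a D
  | none => .apex 1
  | some none => .tip 0
  | some (some i) => .row (Fin.last _) i

theorem coverPortal_injective : Function.Injective (coverPortal (a := a) (D := D)) := by
  rintro (_ | _ | i) (_ | _ | j) h <;> simp_all [coverPortal]

theorem ncard_coverInc (e : CoverEdge a) :
    {v : CoverVertex a D | coverInc v e}.ncard = D + 2 := by
  have key : ∀ (n : Fin (2 * a + 2)) (u w : CoverVertex a D), u ≠ w →
      (∀ i, u ≠ .row n i) → (∀ i, w ≠ .row n i) →
      (insert u (insert w (Set.range (CoverVertex.row n)))).ncard = D + 2 := by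
    intro n u w huw hu hw
    rw [Set.ncard_insert_of_notMem, Set.ncard_insert_of_notMem, ← Set.image_univ,
      Set.ncard_image_of_injective, Set.ncard_univ, Nat.card_fin]
    · intro i j h
      simpa using h
    · rintro ⟨i, h⟩
      exact hw i h.symm
    · rintro (h | ⟨i, h⟩)
      · exact huw h
      · exact hu i h.symm
  rcases e with ⟨n, x⟩ | n
  · rw [← key n (.hub ⟨n % 2, by omega⟩ x) (.tip n) (by simp) (by simp) (by simp)]
    congr 1
    ext (⟨b, y⟩ | ⟨l, i⟩ | l | b) <;> simp [coverInc, Fin.ext_iff, eq_comm]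
  · rw [← key n.castSucc (.apex ⟨n % 2, by omega⟩) (.tip n.succ) (by simp) (by simp) (by simp)]
    congr 1
    ext (⟨b, y⟩ | ⟨l, i⟩ | l | b) <;> simp [coverInc, Fin.ext_iff, eq_comm]

theorem coverInc_injective :
    Function.Injective fun e : CoverEdge a => {v : CoverVertex a D | coverInc v e} := by
  intro e f h
  simp only [Set.ext_iff, Set.mem_ofPred_eq] at h
  rcases e with ⟨n, x⟩ | n <;> rcases f with ⟨l, y⟩ | l
  · have h₁ := (h (.tip n)).1 rfl
    have h₂ := (h (.hub ⟨n % 2, by omega⟩ x)).1 ⟨rfl, rfl⟩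
    simp_all [coverInc]
  · exact ((h (.hub ⟨n % 2, by omega⟩ x)).1 ⟨rfl, rfl⟩).elim
  · exact ((h (.hub ⟨l % 2, by omega⟩ y)).2 ⟨rfl, rfl⟩).elim
  · have h₁ := (h (.tip n.succ)).1 (by simp [coverInc])
    simpa [coverInc, Fin.ext_iff] using h₁

theorem isConformal_coverInc (ha : 0 < a) : IsConformal (coverInc (a := a) (D := D)) := by
  intro s hs
  have hubRow : ∀ {b : Fin 2} {x} {n : Fin (2 * a + 2)} {i}, .hub b x ∈ s → .row n i ∈ s →
      (n : ℕ) % 2 = b := by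
    intro b x n i hu hv
    obtain ⟨e | e, he, he'⟩ := hs _ hu _ hv
    · exact he' ▸ he.1
    · exact he.elim
  have hubTip : ∀ {b : Fin 2} {x} {n : Fin (2 * a + 2)}, .hub b x ∈ s → .tip n ∈ s →
      (n : ℕ) % 2 = b := by
    intro b x n hu hv
    obtain ⟨e | e, he, he'⟩ := hs _ hu _ hv
    · exact he' ▸ he.1
    · exact he.elim
  have hubHub : ∀ {b x b' x'}, .hub b x ∈ s → .hub b' x' ∈ s → b = b' ∧ x = x' := by
    intro b x b' x' hu hv
    obtain ⟨e | e, he, he'⟩ := hs _ hu _ hv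
    · exact ⟨Fin.ext (he.1.symm.trans he'.1), he.2.trans he'.2.symm⟩
    · exact he.elim
  have hubApex : ∀ {b x b'}, .hub b x ∈ s → .apex b' ∉ s := by
    intro b x b' hu hv
    obtain ⟨e | e, he, he'⟩ := hs _ hu _ hv
    · exact he'
    · exact he
  have rowRow : ∀ {n n' : Fin (2 * a + 2)} {i i'}, .row n i ∈ s → .row n' i' ∈ s →
      (n : ℕ) = n' := by
    intro n n' i i' hu hv
    obtain ⟨e | e, he, he'⟩ := hs _ hu _ hv
    · exact congrArg Fin.val (he.trans he'.symm)
    · exact he.trans he'.symm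
  have rowTip : ∀ {n n' : Fin (2 * a + 2)} {i}, .row n i ∈ s → .tip n' ∈ s →
      (n' : ℕ) = n ∨ (n' : ℕ) = n + 1 := by
    intro n n' i hu hv
    obtain ⟨e | e, he, he'⟩ := hs _ hu _ hv
    · exact .inl (congrArg Fin.val (he'.trans he.symm))
    · exact .inr (he'.trans (congrArg (· + 1) he.symm))
  have rowApex : ∀ {n : Fin (2 * a + 2)} {i} {b : Fin 2}, .row n i ∈ s → .apex b ∈ s →
      (n : ℕ) % 2 = b ∧ (n : ℕ) < 2 * a + 1 := by
    intro n i b hu hv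
    obtain ⟨e | e, he, he'⟩ := hs _ hu _ hv
    · exact he'.elim
    · simp only [coverInc] at he he'
      omega
  have tipTip : ∀ {n n' : Fin (2 * a + 2)}, .tip n ∈ s → .tip n' ∈ s → (n : ℕ) = n' := by
    intro n n' hu hv
    obtain ⟨e | e, he, he'⟩ := hs _ hu _ hv
    · exact congrArg Fin.val (he.trans he'.symm)
    · exact he.trans he'.symm
  have tipApex : ∀ {n : Fin (2 * a + 2)} {b : Fin 2}, .tip n ∈ s → .apex b ∈ s →
      0 < (n : ℕ) ∧ ((n : ℕ) - 1) % 2 = b := by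
    intro n b hu hv
    obtain ⟨e | e, he, he'⟩ := hs _ hu _ hv
    · exact he'.elim
    · simp only [coverInc] at he he'
      omega
  have apexApex : ∀ {b b' : Fin 2}, .apex b ∈ s → .apex b' ∈ s → (b : ℕ) = b' := by
    intro b b' hu hv
    obtain ⟨e | e, he, he'⟩ := hs _ hu _ hv
    · exact he.elim
    · exact he.symm.trans he'
  by_cases hH : ∃ b x, .hub b x ∈ s
  · obtain ⟨b, x, hb⟩ := hH
    obtain ⟨n, hnb, hrow, htip⟩ : ∃ n : Fin (2 * a + 2), (n : ℕ) % 2 = b ∧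
        (∀ (n' : Fin (2 * a + 2)) i, .row n' i ∈ s → (n' : ℕ) = n) ∧
        ∀ n' : Fin (2 * a + 2), .tip n' ∈ s → (n' : ℕ) = n := by
      by_cases hR : ∃ n i, .row n i ∈ s
      · obtain ⟨n, i, hn⟩ := hR
        refine ⟨n, hubRow hb hn, fun n' i' h => rowRow h hn, fun n' h => ?_⟩
        have := rowTip hn h
        have := hubRow hb hn
        have := hubTip hb h
        omega
      · by_cases hT : ∃ n, .tip n ∈ s
        · obtain ⟨n, hn⟩ := hT
          exact ⟨n, hubTip hb hn, fun n' i' h => (hR ⟨n', i', h⟩).elim, fun n' h => tipTip h hn⟩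
        · exact ⟨⟨b, by omega⟩, Nat.mod_eq_of_lt b.2, fun n' i' h => (hR ⟨n', i', h⟩).elim,
            fun n' h => (hT ⟨n', h⟩).elim⟩
    refine ⟨.inl (n, x), ?_⟩
    rintro (⟨b', y⟩ | ⟨l, i⟩ | l | b') hv
    · obtain ⟨rfl, rfl⟩ := hubHub hb hv
      exact ⟨hnb, rfl⟩
    · exact Fin.ext (hrow _ _ hv)
    · exact Fin.ext (htip _ hv)
    · exact (hubApex hb hv).elim
  by_cases hA : ∃ b, .apex b ∈ s
  · obtain ⟨b, hb⟩ := hA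
    obtain ⟨n, hnb, hrow, htip⟩ : ∃ n : Fin (2 * a + 1), (n : ℕ) % 2 = b ∧
        (∀ (n' : Fin (2 * a + 2)) i, .row n' i ∈ s → (n' : ℕ) = n) ∧
        ∀ n' : Fin (2 * a + 2), .tip n' ∈ s → (n' : ℕ) = n + 1 := by
      by_cases hR : ∃ n i, .row n i ∈ s
      · obtain ⟨n, i, hn⟩ := hR
        have hnb := rowApex hn hb
        refine ⟨⟨n, hnb.2⟩, hnb.1, fun n' i' h => rowRow h hn, fun n' h => ?_⟩
        have := rowTip hn h
        have := tipApex h hb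
        simp only
        omega
      · by_cases hT : ∃ n, .tip n ∈ s
        · obtain ⟨n, hn⟩ := hT
          have hnb := tipApex hn hb
          refine ⟨⟨n - 1, by omega⟩, hnb.2, fun n' i' h => (hR ⟨n', i', h⟩).elim, fun n' h => ?_⟩
          have := tipTip h hn
          simp only
          omega
        · exact ⟨⟨b, by omega⟩, Nat.mod_eq_of_lt b.2, fun n' i' h => (hR ⟨n', i', h⟩).elim,
            fun n' h => (hT ⟨n', h⟩).elim⟩
    refine ⟨.inr n, ?_⟩
    rintro (⟨b', y⟩ | ⟨l, i⟩ | l | b') hv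
    · exact (hubApex hv hb).elim
    · exact hrow _ _ hv
    · exact htip _ hv
    · exact hnb.trans (apexApex hb hv)
  by_cases hT : ∃ n : Fin (2 * a + 2), .tip n ∈ s ∧
      ∀ (n' : Fin (2 * a + 2)) i, .row n' i ∈ s → (n' : ℕ) = n
  · obtain ⟨n, hn, hrow⟩ := hT
    refine ⟨.inl (n, ⟨0, ha⟩), ?_⟩
    rintro (⟨b', y⟩ | ⟨l, i⟩ | l | b') hv
    · exact (hH ⟨_, _, hv⟩).elim
    · exact Fin.ext (hrow _ _ hv)
    · exact Fin.ext (tipTip hv hn)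
    · exact (hA ⟨_, hv⟩).elim
  by_cases hR : ∃ n i, .row n i ∈ s
  · obtain ⟨n, i, hn⟩ := hR
    have htip : ∀ n' : Fin (2 * a + 2), .tip n' ∈ s → (n' : ℕ) = n + 1 := by
      intro n' h
      refine (rowTip hn h).resolve_left fun h' => hT ⟨n', h, fun l j hl => ?_⟩
      exact (rowRow hl hn).trans h'.symm
    by_cases hlt : (n : ℕ) < 2 * a + 1
    · refine ⟨.inr ⟨n, hlt⟩, ?_⟩
      rintro (⟨b', y⟩ | ⟨l, i⟩ | l | b') hv
      · exact (hH ⟨_, _, hv⟩).elim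
      · exact rowRow hv hn
      · exact htip _ hv
      · exact (hA ⟨_, hv⟩).elim
    · refine ⟨.inl (n, ⟨0, ha⟩), ?_⟩
      rintro (⟨b', y⟩ | ⟨l, i⟩ | l | b') hv
      · exact (hH ⟨_, _, hv⟩).elim
      · exact Fin.ext (rowRow hv hn)
      · have := htip _ hv
        omega
      · exact (hA ⟨_, hv⟩).elim
  · refine ⟨.inl (0, ⟨0, ha⟩), ?_⟩
    rintro (⟨b', y⟩ | ⟨l, i⟩ | l | b') hv
    · exact (hH ⟨_, _, hv⟩).elim
    · exact (hR ⟨_, _, hv⟩).elim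
    · exact (hT ⟨l, hv, fun n' i' h => (hR ⟨n', i', h⟩).elim⟩).elim
    · exact (hA ⟨_, hv⟩).elim

theorem sum_range_parity (a y : ℕ) :
    ((∑ n ∈ Finset.range (2 * a + 1), if n % 2 = 0 then y else 0) = (a + 1) * y) ∧
    ((∑ n ∈ Finset.range (2 * a + 1), if n % 2 = 1 then y else 0) = a * y) := by
  induction a with
  | zero => simp
  | succ a ih =>
    have h₁ : (2 * a + 1) % 2 = 1 := by omega
    have h₂ : (2 * a + 1 + 1) % 2 = 0 := by omega
    rw [show 2 * (a + 1) + 1 = 2 * a + 1 + 1 + 1 by ring]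
    simp only [Finset.sum_range_succ _ (2 * a + 1), Finset.sum_range_succ _ (2 * a + 1 + 1), ih,
      h₁, h₂]
    constructor <;> simp <;> ring

theorem sum_fin_parity (a : ℕ) (b : Fin 2) :
    (∑ n : Fin (2 * a + 2), if (n : ℕ) % 2 = b then 1 else 0) = a + 1 := by
  rw [Fin.sum_univ_eq_sum_range fun n => if n % 2 = (b : ℕ) then 1 else 0, Finset.sum_range_succ]
  have h := sum_range_parity a 1
  have h₁ : (2 * a + 1) % 2 = 1 := by omega
  fin_cases b <;> simp_all

theorem sum_coverInc_hub (m : CoverEdge a → ℕ) (b : Fin 2) (x : Fin a) :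
    (∑ e, if coverInc (.hub b x : CoverVertex a D) e then m e else 0) =
      ∑ n : Fin (2 * a + 2), if (n : ℕ) % 2 = b then m (.inl (n, x)) else 0 := by
  rw [Fintype.sum_sum_type, Fintype.sum_prod_type]
  refine (congrArg₂ _ (Finset.sum_congr rfl fun n _ => ?_)
    (Finset.sum_eq_zero fun l _ => if_neg id)).trans (add_zero _)
  rw [Finset.sum_eq_single x]
  · exact if_congr (and_iff_left rfl) rfl rfl
  · exact fun y _ hy => if_neg fun h => hy h.2.symm
  · simp

theorem sum_coverInc_row (m : CoverEdge a → ℕ) (n : Fin (2 * a + 2)) (i : Fin D) :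
    (∑ e, if coverInc (.row n i) e then m e else 0) =
      (∑ x, m (.inl (n, x))) + ∑ l : Fin (2 * a + 1), if (n : ℕ) = l then m (.inr l) else 0 := by
  rw [Fintype.sum_sum_type, Fintype.sum_prod_type, Finset.sum_eq_single n]
  · exact congrArg₂ _ (Finset.sum_congr rfl fun x _ => if_pos rfl)
      (Finset.sum_congr rfl fun l _ => if_congr Iff.rfl rfl rfl)
  · exact fun l _ hl => Finset.sum_eq_zero fun x _ => if_neg fun h => hl (Eq.symm h)
  · simp

theorem sum_coverInc_tip (m : CoverEdge a → ℕ) (n : Fin (2 * a + 2)) :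
    (∑ e, if coverInc (.tip n : CoverVertex a D) e then m e else 0) =
      (∑ x, m (.inl (n, x))) +
        ∑ l : Fin (2 * a + 1), if (n : ℕ) = l + 1 then m (.inr l) else 0 := by
  rw [Fintype.sum_sum_type, Fintype.sum_prod_type, Finset.sum_eq_single n]
  · exact congrArg₂ _ (Finset.sum_congr rfl fun x _ => if_pos rfl)
      (Finset.sum_congr rfl fun l _ => if_congr Iff.rfl rfl rfl)
  · exact fun l _ hl => Finset.sum_eq_zero fun x _ => if_neg fun h => hl (Eq.symm h)
  · simp

theorem sum_coverInc_apex (m : CoverEdge a → ℕ) (b : Fin 2) :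
    (∑ e, if coverInc (.apex b : CoverVertex a D) e then m e else 0) =
      ∑ l : Fin (2 * a + 1), if (l : ℕ) % 2 = b then m (.inr l) else 0 := by
  rw [Fintype.sum_sum_type]
  refine (congrArg₂ _ (Finset.sum_eq_zero fun e _ => if_neg id)
    (Finset.sum_congr rfl fun l _ => ?_)).trans (zero_add _)
  exact if_congr Iff.rfl rfl rfl

theorem sum_fin_ite_eq (m : Fin (2 * a + 1) → ℕ) {n : ℕ} (hn : n < 2 * a + 1) :
    (∑ l : Fin (2 * a + 1), if n = (l : ℕ) then m l else 0) = m ⟨n, hn⟩ := by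
  rw [Finset.sum_eq_single ⟨n, hn⟩]
  · simp
  · intro l _ hl
    rw [if_neg fun h => hl (Fin.ext h.symm)]
  · simp

theorem degree_coverInc (v : CoverVertex a D) :
    (∑ e, if coverInc v e then 1 else 0) =
      if v ∈ Set.range coverPortal then a else a + 1 := by
  have hmem : v ∈ Set.range coverPortal ↔
      v = .apex 1 ∨ v = .tip 0 ∨ ∃ i, v = .row (Fin.last _) i := by
    constructor
    · rintro ⟨_ | _ | i, rfl⟩
      · exact .inl rfl
      · exact .inr (.inl rfl)
      · exact .inr (.inr ⟨i, rfl⟩)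
    · rintro (rfl | rfl | ⟨i, rfl⟩)
      · exact ⟨none, rfl⟩
      · exact ⟨some none, rfl⟩
      · exact ⟨some (some i), rfl⟩
  rcases v with ⟨b, x⟩ | ⟨n, i⟩ | n | b
  · rw [sum_coverInc_hub fun _ => 1, if_neg (by simp [hmem])]
    exact sum_fin_parity a b
  · rw [sum_coverInc_row fun _ => 1]
    simp only [hmem, reduceCtorEq, false_or, CoverVertex.row.injEq, exists_and_left]
    by_cases hn : (n : ℕ) < 2 * a + 1
    · rw [sum_fin_ite_eq (fun _ => 1) hn, if_neg]
      · simp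
      · rintro ⟨rfl, -⟩
        simp at hn
    · rw [Finset.sum_eq_zero fun l _ => if_neg (by omega), if_pos]
      · simp
      · exact ⟨Fin.ext (by simp; omega), i, rfl⟩
  · rw [sum_coverInc_tip fun _ => 1]
    simp only [hmem, reduceCtorEq, false_or, CoverVertex.tip.injEq, exists_false, or_false]
    by_cases hn : n = 0
    · subst hn
      simp
    · obtain ⟨l, rfl⟩ := Fin.exists_succ_eq.2 hn
      simp only [Fin.val_succ, Nat.add_right_cancel_iff, if_neg hn]
      rw [sum_fin_ite_eq (fun _ => 1) l.2]
      simp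
  · rw [sum_coverInc_apex fun _ => 1]
    simp only [hmem, reduceCtorEq, CoverVertex.apex.injEq, exists_false, or_false]
    rw [Fin.sum_univ_eq_sum_range fun n => if n % 2 = (b : ℕ) then 1 else 0]
    have h := sum_range_parity a 1
    fin_cases b <;> simp_all

theorem coverInc_forces (hD : 0 < D) (m : CoverEdge a → ℕ)
    (hm : ∀ v : CoverVertex a D, v ∉ Set.range coverPortal →
      (∑ e, if coverInc v e then m e else 0) = a + 1) (i : Option (Option (Fin D))) :
    (∑ e, if coverInc (coverPortal i) e then m e else 0) = a := by
  set t : Fin (2 * a + 2) → ℕ := fun n => ∑ x, m (.inl (n, x)) with ht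
  set y : Fin (2 * a + 1) → ℕ := fun n => m (.inr n) with hy
  have hrow : ∀ n, t n.castSucc + y n = a + 1 := by
    intro n
    have h := hm (.row n.castSucc ⟨0, hD⟩) (by
      rintro ⟨_ | _ | j, h⟩ <;> simp [coverPortal] at h
      have := congrArg Fin.val h.1
      simp at this
      omega)
    rwa [sum_coverInc_row, Fin.val_castSucc, sum_fin_ite_eq (fun l => m (.inr l)) n.2] at h
  have htip : ∀ n, t n.succ + y n = a + 1 := by
    intro n
    have h := hm (.tip n.succ) (by
      rintro ⟨_ | _ | j, h⟩ <;> simp [coverPortal] at h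
      exact absurd h.symm (Fin.succ_ne_zero n))
    simp only [sum_coverInc_tip, Fin.val_succ, Nat.add_right_cancel_iff] at h
    rwa [sum_fin_ite_eq (fun l => m (.inr l)) n.2] at h
  have hconst : ∀ n (hn : n < 2 * a + 1), y ⟨n, hn⟩ = y 0 := by
    intro n
    induction n with
    | zero => intro _; rfl
    | succ n ih =>
      intro hn
      have h₁ := htip ⟨n, by omega⟩
      have h₂ := hrow ⟨n + 1, hn⟩
      have h₃ := ih (by omega)
      simp only [Fin.succ_mk, Fin.castSucc_mk] at h₁ h₂
      omega
  have hapex : ∀ b : Fin 2, (∑ e, if coverInc (.apex b : CoverVertex a D) e then m e else 0) =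
      ∑ n ∈ Finset.range (2 * a + 1), if n % 2 = (b : ℕ) then y 0 else 0 := by
    intro b
    rw [sum_coverInc_apex, ← Fin.sum_univ_eq_sum_range fun n => if n % 2 = (b : ℕ) then y 0 else 0]
    exact Finset.sum_congr rfl fun l _ => by rw [← hconst l l.2]
  have hone : y 0 = 1 := by
    have h := hm (.apex 0) (by rintro ⟨_ | _ | j, h⟩ <;> simp [coverPortal] at h)
    rw [hapex, Fin.val_zero, (sum_range_parity a _).1] at h
    exact Nat.eq_of_mul_eq_mul_left a.succ_pos (h.trans (mul_one _).symm)
  rcases i with _ | _ | i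
  · refine (hapex 1).trans ?_
    rw [Fin.val_one, (sum_range_parity a _).2, hone, mul_one]
  · refine (sum_coverInc_tip m 0).trans ?_
    rw [Finset.sum_eq_zero fun l _ => if_neg (by simp)]
    have h : t 0 + y 0 = a + 1 := hrow 0
    exact Nat.add_right_cancel (hone ▸ h)
  · refine (sum_coverInc_row m (Fin.last _) i).trans ?_
    rw [Finset.sum_eq_zero fun l _ => if_neg (by simp; omega)]
    have h := htip (Fin.last _)
    have hl : y (Fin.last _) = 1 := (hconst _ _).trans hone
    rw [hl, Fin.succ_last] at h
    exact Nat.add_right_cancel h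

end Cover

/-- For `c ≥ 2`, `d ≥ 3`, `H = K_d` and `k ≥ 1` there is a gadget with
exactly `k·d` portal vertices strictly `(c,H)`-realizing the single-tuple relation
`COVER = {(c−1,…,c−1)}`. -/
theorem statement5 (c d k : ℕ) (hc : 2 ≤ c) (hd : 3 ≤ d) (hk : 1 ≤ k) :
    ∃ (V : Type) (_ : Fintype V) (G : SimpleGraph V) (portals : Fin (k * d) → V),
      Function.Injective portals ∧
      StrictRealizes (⊤ : SimpleGraph (Fin d)) c G portals
        {r : Fin (k * d) → ℕ | ∀ i, r i = c - 1} := by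
  obtain ⟨a, rfl⟩ : ∃ a, c = a + 1 := ⟨c - 1, by omega⟩
  obtain ⟨D, rfl⟩ : ∃ D, d = D + 2 := ⟨d - 2, by omega⟩
  have : Nonempty (Fin k) := ⟨⟨0, hk⟩⟩
  let φ : Fin (k * (D + 2)) ≃ Fin k × Option (Option (Fin D)) :=
    finProdFinEquiv.symm.trans ((Equiv.refl _).prodCongr
      ((finSuccEquiv (D + 1)).trans (finSuccEquiv D).optionCongr))
  let portals : Fin (k * (D + 2)) → Fin k × CoverVertex a D :=
    fun i => ((φ i).1, coverPortal (φ i).2)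
  have hrange : ∀ v, v ∈ Set.range portals ↔ v.2 ∈ Set.range coverPortal := by
    rintro ⟨j, v⟩
    constructor
    · rintro ⟨i, h⟩
      exact ⟨(φ i).2, congrArg Prod.snd h⟩
    · rintro ⟨p, h⟩
      exact ⟨φ.symm (j, p), by simpa [portals] using h⟩
  refine ⟨Fin k × CoverVertex a D, inferInstance, incGraph (copies (Fin k) coverInc), portals, ?_,
    strictRealizes_incGraph (by omega) (fun e => ?_) (isConformal_coverInc (by omega)).copies
      (copies_injective (fun e => ?_) coverInc_injective) (fun v hv => ?_) (fun i => ?_)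
      fun m hm i => ?_⟩
  · intro i j h
    obtain ⟨h₁, h₂⟩ := Prod.mk.inj h
    exact φ.injective (Prod.ext h₁ (coverPortal_injective h₂))
  · rw [ncard_copies, ncard_coverInc]
  · exact Set.nonempty_of_ncard_ne_zero (by rw [ncard_coverInc]; omega)
  · rw [sum_copies fun _ => 1, degree_coverInc, if_neg ((hrange v).not.1 hv)]
  · rw [sum_copies fun _ => 1, degree_coverInc, if_pos ⟨_, rfl⟩, Nat.add_sub_cancel]
  · rw [sum_copies, Nat.add_sub_cancel]
    refine coverInc_forces (by omega) (fun e => m ((φ i).1, e)) (fun v hv => ?_) _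
    rw [← hm ((φ i).1, v) ((hrange _).not.2 hv), sum_copies]
end

section
/- Let H be a fixed graph, G a finite graph, and let V_{t_1}, V_{t_2} ⊆ V(G) be finite sets with X_t = V_{t_1} ∩ V_{t_2} such that no edge of G joins a vertex of V_{t_1}∖X_t to a vertex of V_{t_2}∖X_t; set V_t = V_{t_1} ∪ V_{t_2}. If K^1 is a type for (V_{t_1}, X_t) and K^2 is a type for (V_{t_2}, X_t) and K^1, K^2 are compatible, then K^1 ⊕ K^2 is a type for (V_t, X_t). -/
/-! Framework for the dynamic programming over tree decompositions for
`H`-Packing: partial `H`-packings, types, and the table value `A[(V_t,X_t),K]`. -/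

/-- A partial `H`-packing in `G[Vt]` with bag `Xt`, with `q` partial copies.
`p` is the number of full copies; `full i` are injective homomorphisms from `H` into
`G[Vt] − Xt`; each `hbar j` is (on `S j`) an injective homomorphism from `H[S j]` into
`G[Vt]` whose image meets `Xt`, with border vertices of `S j` mapped into `Xt`; all
images are pairwise vertex-disjoint. -/
structure PartialPacking {α β : Type} (H : SimpleGraph α) (G : SimpleGraph β)
    (Vt Xt : Set β) (q : ℕ) where
  p : ℕ
  full : Fin p → α → β
  S : Fin q → Set α
  hbar : Fin q → α → β
  full_inj : ∀ i, Function.Injective (full i)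
  full_mem : ∀ i x, full i x ∈ Vt \ Xt
  full_hom : ∀ i x y, H.Adj x y → G.Adj (full i x) (full i y)
  S_nonempty : ∀ j, (S j).Nonempty
  hbar_injOn : ∀ j, Set.InjOn (hbar j) (S j)
  hbar_mem : ∀ j, ∀ x ∈ S j, hbar j x ∈ Vt
  hbar_hom : ∀ j, ∀ x ∈ S j, ∀ y ∈ S j, H.Adj x y → G.Adj (hbar j x) (hbar j y)
  hbar_meets : ∀ j, ∃ x ∈ S j, hbar j x ∈ Xt
  border_mem : ∀ j, ∀ x ∈ S j, (∃ y, y ∉ S j ∧ H.Adj x y) → hbar j x ∈ Xt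
  disj_ff : ∀ i i', i ≠ i' → ∀ x y, full i x ≠ full i' y
  disj_fh : ∀ i j x, ∀ y ∈ S j, full i x ≠ hbar j y
  disj_hh : ∀ j j', j ≠ j' → ∀ x ∈ S j, ∀ y ∈ S j', hbar j x ≠ hbar j' y

/-- A type for the bag `Xt` with `q` classes.  `part x = some j` means `x` belongs to
class `j` (and `part x = none` means class `0`); `Z j ⊆ V(H)` is nonempty with
`|Z j| = |part⁻¹(j)|`; `phi j : V(H) → Xt(j) ∪ {↓,↑}` (`Sum.inr false = ↓`,
`Sum.inr true = ↑`) restricts on `Z j = phi j ⁻¹(Xt(j))` to an injective homomorphism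
from `H[Z j]` into `G[Xt(j)]`, and no edge of `H` joins an `↑`-vertex to a `↓`-vertex. -/
structure PackingType {α β : Type} (H : SimpleGraph α) (G : SimpleGraph β)
    (Xt : Set β) (q : ℕ) where
  part : β → Option (Fin q)
  Z : Fin q → Set α
  phi : Fin q → α → β ⊕ Bool
  part_none : ∀ x, x ∉ Xt → part x = none
  Z_nonempty : ∀ j, (Z j).Nonempty
  Z_card : ∀ j, Nat.card (Z j) = Nat.card {x : β // part x = some j}
  phi_inl : ∀ j x y, phi j x = Sum.inl y → x ∈ Z j ∧ part y = some j
  phi_Z : ∀ j, ∀ x ∈ Z j, ∃ y, phi j x = Sum.inl y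
  phi_injOn : ∀ j x x' y, phi j x = Sum.inl y → phi j x' = Sum.inl y → x = x'
  phi_hom : ∀ j x x' y y', phi j x = Sum.inl y → phi j x' = Sum.inl y' →
    H.Adj x x' → G.Adj y y'
  no_updown : ∀ j x x', phi j x = Sum.inr true → phi j x' = Sum.inr false → ¬ H.Adj x x'

/-- The partial packing `P` has type `K`. -/
def HasType {α β : Type} {H : SimpleGraph α} {G : SimpleGraph β}
    {Vt Xt : Set β} {q : ℕ}
    (P : PartialPacking H G Vt Xt q) (K : PackingType H G Xt q) : Prop :=
  (∀ x ∈ Xt, ∀ j : Fin q, (K.part x = some j ↔ ∃ y ∈ P.S j, P.hbar j y = x)) ∧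
  (∀ j : Fin q, ∀ x, x ∉ P.S j → K.phi j x = Sum.inr true) ∧
  (∀ j : Fin q, ∀ x ∈ P.S j, P.hbar j x ∈ Xt → K.phi j x = Sum.inl (P.hbar j x)) ∧
  (∀ j : Fin q, ∀ x ∈ P.S j, P.hbar j x ∉ Xt → K.phi j x = Sum.inr false) ∧
  (∀ j : Fin q, K.Z j = {x | x ∈ P.S j ∧ P.hbar j x ∈ Xt})

/-- `A[(Vt,Xt), K]`: the maximum number of full copies over all partial `H`-packings in
`G[Vt]` of type `K` (`0` if there is none). -/
noncomputable def Aval {α β : Type} (H : SimpleGraph α) (G : SimpleGraph β)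
    (Vt Xt : Set β) {q : ℕ} (K : PackingType H G Xt q) : ℕ :=
  sSup {n | ∃ P : PartialPacking H G Vt Xt q, HasType P K ∧ P.p = n}

/-- Pointwise sum of two imprint values: `↑ ⊕ b = b`, and otherwise the first value. -/
def oplusVal {β : Type} : β ⊕ Bool → β ⊕ Bool → β ⊕ Bool
  | Sum.inr true, b => b
  | a, _ => a

/-- The types `K1`, `K2` (for the two children of a join node, over the same bag) are
compatible. -/
def Compatible {α β : Type} {H : SimpleGraph α} {G : SimpleGraph β} {Xt : Set β} {q : ℕ}
    (K1 K2 : PackingType H G Xt q) : Prop :=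
  K1.part = K2.part ∧ (∀ j, K1.Z j = K2.Z j) ∧
  (∀ j, ∀ x ∈ K1.Z j, K1.phi j x = K2.phi j x) ∧
  (∀ j x, ¬ (K1.phi j x = Sum.inr false ∧ K2.phi j x = Sum.inr false))

/-- `K` is the sum `K1 ⊕ K2` of the compatible types `K1` and `K2` (characterized by
its data). -/
def OplusEq {α β : Type} {H : SimpleGraph α} {G : SimpleGraph β} {Xt : Set β} {q : ℕ}
    (K1 K2 K : PackingType H G Xt q) : Prop :=
  K.part = K1.part ∧ (∀ j, K.Z j = K1.Z j) ∧
  ∀ j x, K.phi j x = oplusVal (K1.phi j x) (K2.phi j x)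

theorem oplusVal_eq_up_iff {β : Type} (a b : β ⊕ Bool) :
    oplusVal a b = Sum.inr true ↔ a = Sum.inr true ∧ b = Sum.inr true := by
  rcases a with a | _ | _ <;> simp [oplusVal]

theorem oplusVal_eq_down {β : Type} {a b : β ⊕ Bool} (h : oplusVal a b = Sum.inr false) :
    a = Sum.inr false ∨ b = Sum.inr false := by
  rcases a with a | _ | _ <;> simp_all [oplusVal]

theorem Compatible.oplusVal_eq_inl_iff {α β : Type} {H : SimpleGraph α} {G : SimpleGraph β}
    {Xt : Set β} {q : ℕ} {K1 K2 : PackingType H G Xt q} (h : Compatible K1 K2)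
    (j : Fin q) (x : α) (y : β) :
    oplusVal (K1.phi j x) (K2.phi j x) = Sum.inl y ↔ K1.phi j x = Sum.inl y := by
  obtain ⟨-, hZ, hphi, -⟩ := h
  rcases h1 : K1.phi j x with a | _ | _
  · simp [oplusVal]
  · simp [oplusVal]
  · simp only [oplusVal, reduceCtorEq, iff_false]
    intro h2
    have hx : x ∈ K1.Z j := hZ j ▸ (K2.phi_inl j x y h2).1
    have := hphi j x hx
    simp_all

/-- The sum `K1 ⊕ K2` of two compatible types. -/
def PackingType.oplus {α β : Type} {H : SimpleGraph α} {G : SimpleGraph β}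
    {Xt : Set β} {q : ℕ} (K1 K2 : PackingType H G Xt q) (h : Compatible K1 K2) :
    PackingType H G Xt q where
  part := K1.part
  Z := K1.Z
  phi j x := oplusVal (K1.phi j x) (K2.phi j x)
  part_none := K1.part_none
  Z_nonempty := K1.Z_nonempty
  Z_card := K1.Z_card
  phi_inl j x y := by
    rw [h.oplusVal_eq_inl_iff]
    exact K1.phi_inl j x y
  phi_Z j x hx := by
    simp only [h.oplusVal_eq_inl_iff]
    exact K1.phi_Z j x hx
  phi_injOn j x x' y := by
    rw [h.oplusVal_eq_inl_iff, h.oplusVal_eq_inl_iff]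
    exact K1.phi_injOn j x x' y
  phi_hom j x x' y y' := by
    rw [h.oplusVal_eq_inl_iff, h.oplusVal_eq_inl_iff]
    exact K1.phi_hom j x x' y y'
  no_updown j x x' hx hdown := by
    obtain ⟨hx1, hx2⟩ := (oplusVal_eq_up_iff _ _).1 hx
    rcases oplusVal_eq_down hdown with hdown | hdown
    · exact K1.no_updown j x x' hx1 hdown
    · exact K2.no_updown j x x' hx2 hdown

/-- With `X_t = V_{t_1} ∩ V_{t_2}`, no edge between `V_{t_1} ∖ X_t`
and `V_{t_2} ∖ X_t`, and `V_t = V_{t_1} ∪ V_{t_2}`: if `K1` and `K2` are compatible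
types for the bag `X_t` (of the two children), then their sum `K1 ⊕ K2` is again a
(valid) type for the bag `X_t` (of the join node), i.e. there is a type `K` whose data
is exactly that of `K1 ⊕ K2`. -/
theorem statement17 {α β : Type} (H : SimpleGraph α) (G : SimpleGraph β)
    (Vt1 Vt2 Vt Xt : Set β) (h1 : Vt1.Finite) (h2 : Vt2.Finite)
    (hX : Xt = Vt1 ∩ Vt2) (hV : Vt = Vt1 ∪ Vt2)
    (hsep : ∀ x ∈ Vt1 \ Xt, ∀ y ∈ Vt2 \ Xt, ¬ G.Adj x y)
    {q : ℕ} (K1 K2 : PackingType H G Xt q) (hcomp : Compatible K1 K2) :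
    ∃ K : PackingType H G Xt q, OplusEq K1 K2 K := by
  exact ⟨K1.oplus K2 hcomp, rfl, fun _ => rfl, fun _ _ => rfl⟩
end
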